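/- (Integrality) Let A be a Seifert matrix of type (m_1,…,m_n) and let f be a noncommutative polynomial in x and z all of whose coefficients are integers. Then tr f(X, Z_A) lies in the image of the canonical map FreeAlgebra ℤ (Fin n) → FreeAlgebra ℚ (Fin n); i.e., all coefficients of tr f(X, Z_A) in the monomial basis of F_n are integers. The same holds for χ_f(A). -/

import Mathlib

open Matrix

/-- Index type for `m × m` matrices partitioned into `n` blocks, the `i`-th of size `msize i`. -/
abbrev BlkIdx {n : ℕ} (msize : Fin n → ℕ) : Type := (i : Fin n) × Fin (msize i)

/-- The block-diagonal matrix `X` over the free algebra `F_n = ℚ⟨x_1,…,x_n⟩`,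
whose `i`-th diagonal block is `x_i` times the identity. -/
noncomputable def Xblk {n : ℕ} (msize : Fin n → ℕ) :
    Matrix (BlkIdx msize) (BlkIdx msize) (FreeAlgebra ℚ (Fin n)) :=
  Matrix.diagonal fun p => FreeAlgebra.ι ℚ p.1

/-- `Z_A = A · (A − Aᵀ)⁻¹`. -/
noncomputable def Zof {ι : Type*} [Fintype ι] [DecidableEq ι] (A : Matrix ι ι ℚ) :
    Matrix ι ι ℚ :=
  A * (A - Aᵀ)⁻¹

/-- Evaluation `f ↦ f(X, Z)` : the image of `f ∈ ℚ⟨x,z⟩` under the algebra homomorphism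
`ℚ⟨x,z⟩ → M_m(F_n)`, `x ↦ X`, `z ↦ Z`. -/
noncomputable def evalf {n : ℕ} {ι : Type*} [Fintype ι] [DecidableEq ι]
    (X Z : Matrix ι ι (FreeAlgebra ℚ (Fin n))) (f : FreeAlgebra ℚ (Fin 2)) :
    Matrix ι ι (FreeAlgebra ℚ (Fin n)) :=
  FreeAlgebra.lift ℚ ![X, Z] f

/-- A Seifert matrix of type `(msize 1, …, msize n)`: an integer matrix with blocks `A_{ij}`
satisfying `(A_{ij})ᵀ = A_{ji}` for `i ≠ j` and `det (A_{ii} − (A_{ii})ᵀ) = 1` for all `i`. -/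
def IsSeifert {n : ℕ} (msize : Fin n → ℕ)
    (A : Matrix (BlkIdx msize) (BlkIdx msize) ℤ) : Prop :=
  (∀ (i j : Fin n), i ≠ j → ∀ (a : Fin (msize i)) (b : Fin (msize j)),
      A ⟨i, a⟩ ⟨j, b⟩ = A ⟨j, b⟩ ⟨i, a⟩) ∧
  (∀ i : Fin n, (Matrix.of fun a b : Fin (msize i) =>
      A ⟨i, a⟩ ⟨i, b⟩ - A ⟨i, b⟩ ⟨i, a⟩).det = 1)

/-- A diagonal-entry function taking values in `{0,1}` with exactly half of the entries in
each block equal to `1` (the matrix `I_{1/2}`). -/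
def IsHalfOnes {n : ℕ} (msize : Fin n → ℕ) (d : BlkIdx msize → ℚ) : Prop :=
  (∀ p, d p = 0 ∨ d p = 1) ∧
  (∀ i : Fin n,
    2 * (Finset.univ.filter fun a : Fin (msize i) => d ⟨i, a⟩ = 1).card = msize i)

/-- The reversal anti-automorphism of a free associative algebra, fixing each generator. -/
noncomputable def rev {σ : Type*} (a : FreeAlgebra ℚ σ) : FreeAlgebra ℚ σ :=
  MulOpposite.unop
    (FreeAlgebra.lift ℚ (fun i => MulOpposite.op (FreeAlgebra.ι ℚ i)) a)

/-- View a rational matrix as a matrix over the free algebra `F_n`. -/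
noncomputable def mapQ {n : ℕ} {ι κ : Type*} (Z : Matrix ι κ ℚ) :
    Matrix ι κ (FreeAlgebra ℚ (Fin n)) :=
  Z.map (algebraMap ℚ (FreeAlgebra ℚ (Fin n)))

/-- The canonical map `FreeAlgebra ℤ (Fin k) → FreeAlgebra ℚ (Fin k)` (its range consists
of the elements all of whose coefficients in the monomial basis are integers). -/
noncomputable def intMap (k : ℕ) : FreeAlgebra ℤ (Fin k) →ₐ[ℤ] FreeAlgebra ℚ (Fin k) :=
  FreeAlgebra.lift ℤ (FreeAlgebra.ι ℚ : Fin k → FreeAlgebra ℚ (Fin k))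

lemma evalf_int {n : ℕ} (msize : Fin n → ℕ) (W : Matrix (BlkIdx msize) (BlkIdx msize) ℤ)
    (g : FreeAlgebra ℤ (Fin 2)) (a b : BlkIdx msize) :
    evalf (Xblk msize) (mapQ (W.map ((↑) : ℤ → ℚ))) (intMap 2 g) a b ∈ (intMap n).range := by
  induction g using FreeAlgebra.induction generalizing a b with
  | grade0 r =>
    have h : evalf (Xblk msize) (mapQ (W.map ((↑) : ℤ → ℚ)))
        (intMap 2 (algebraMap ℤ _ r)) = ((r : ℤ) : Matrix _ _ (FreeAlgebra ℚ (Fin n))) := by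
      simp [evalf]
    rw [h, Matrix.intCast_apply]
    split_ifs
    · exact intCast_mem _ r
    · exact zero_mem _
  | grade1 x =>
    have h : intMap 2 (FreeAlgebra.ι ℤ x) = FreeAlgebra.ι ℚ x := by simp [intMap]
    rw [h, evalf, FreeAlgebra.lift_ι_apply]
    fin_cases x
    · simp only [Xblk, Fin.zero_eta, Matrix.cons_val_zero, Matrix.diagonal_apply]
      split_ifs
      · exact ⟨FreeAlgebra.ι ℤ a.1, by simp [intMap]⟩
      · exact zero_mem _
    · have h2 : mapQ (n := n) (W.map ((↑) : ℤ → ℚ)) a b = ((W a b : ℤ) : FreeAlgebra ℚ (Fin n)) := by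
        simp [mapQ]
      simp only [Fin.mk_one, Matrix.cons_val_one, Matrix.cons_val_fin_one]
      rw [h2]
      exact intCast_mem _ _
  | mul g h ihg ihh =>
    rw [map_mul]
    simp only [evalf, map_mul] at *
    rw [Matrix.mul_apply]
    exact sum_mem fun c _ => mul_mem (ihg a c) (ihh c b)
  | add g h ihg ihh =>
    rw [map_add]
    simp only [evalf, map_add] at *
    rw [Matrix.add_apply]
    exact add_mem (ihg a b) (ihh a b)

lemma trace_int {n : ℕ} (msize : Fin n → ℕ) (W : Matrix (BlkIdx msize) (BlkIdx msize) ℤ)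
    (g : FreeAlgebra ℤ (Fin 2)) :
    (evalf (Xblk msize) (mapQ (W.map ((↑) : ℤ → ℚ))) (intMap 2 g)).trace ∈ (intMap n).range :=
  sum_mem fun c _ => evalf_int msize W g c c

lemma seifert_det {n : ℕ} (msize : Fin n → ℕ)
    (A : Matrix (BlkIdx msize) (BlkIdx msize) ℤ) (hA : IsSeifert msize A) :
    IsUnit (A - Aᵀ).det := by
  have h : A - Aᵀ = Matrix.blockDiagonal' (fun i => Matrix.of fun a b : Fin (msize i) =>
      A ⟨i, a⟩ ⟨i, b⟩ - A ⟨i, b⟩ ⟨i, a⟩) := by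
    ext ⟨i, a⟩ ⟨j, b⟩
    by_cases hij : i = j
    · subst hij
      simp [Matrix.blockDiagonal'_apply]
    · simp [Matrix.blockDiagonal'_apply, hij, hA.1 i j hij a b]
  rw [h]
  refine Matrix.isUnit_det_of_right_inverse (B := Matrix.blockDiagonal' fun i =>
    (Matrix.of fun a b : Fin (msize i) => A ⟨i, a⟩ ⟨i, b⟩ - A ⟨i, b⟩ ⟨i, a⟩)⁻¹) ?_
  rw [← Matrix.blockDiagonal'_mul, ← Matrix.blockDiagonal'_one]
  congr 1
  funext i
  exact Matrix.mul_nonsing_inv _ (by rw [hA.2 i]; exact isUnit_one)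

lemma Zof_int {n : ℕ} (msize : Fin n → ℕ)
    (A : Matrix (BlkIdx msize) (BlkIdx msize) ℤ) (hA : IsSeifert msize A) :
    Zof (A.map ((↑) : ℤ → ℚ)) = (A * (A - Aᵀ)⁻¹).map ((↑) : ℤ → ℚ) := by
  have hd := seifert_det msize A hA
  have h1 : (A - Aᵀ) * (A - Aᵀ)⁻¹ = 1 := Matrix.mul_nonsing_inv _ hd
  have h2 : A.map ((↑) : ℤ → ℚ) - (A.map ((↑) : ℤ → ℚ))ᵀ = (A - Aᵀ).map ((↑) : ℤ → ℚ) := by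
    ext; simp
  have key : ∀ M N : Matrix (BlkIdx msize) (BlkIdx msize) ℤ,
      (M * N).map ((↑) : ℤ → ℚ) = M.map ((↑) : ℤ → ℚ) * N.map ((↑) : ℤ → ℚ) :=
    fun M N => Matrix.map_mul (f := Int.castRingHom ℚ)
  have h3 : ((A - Aᵀ).map ((↑) : ℤ → ℚ))⁻¹ = ((A - Aᵀ)⁻¹).map ((↑) : ℤ → ℚ) := by
    apply Matrix.inv_eq_right_inv
    rw [← key, h1]
    exact Matrix.map_one _ Int.cast_zero Int.cast_one
  rw [Zof, h2, h3, key]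

/-- Integrality: if `f` has integer coefficients then `tr f(X, Z_A)` has
integer coefficients, and so does `χ_f(A)`. -/
theorem stmt18 {n : ℕ} (hn : 1 ≤ n) (msize : Fin n → ℕ)
    (hpos : ∀ i, 0 < msize i) (heven : ∀ i, Even (msize i))
    (A : Matrix (BlkIdx msize) (BlkIdx msize) ℤ) (hA : IsSeifert msize A)
    (f : FreeAlgebra ℚ (Fin 2)) (hf : f ∈ Set.range (intMap 2)) :
    (evalf (Xblk msize) (mapQ (Zof (A.map ((↑) : ℤ → ℚ)))) f).trace ∈
      Set.range (intMap n) ∧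
    ∀ d : BlkIdx msize → ℚ, IsHalfOnes msize d →
      (evalf (Xblk msize) (mapQ (Zof (A.map ((↑) : ℤ → ℚ)))) f).trace -
          (evalf (Xblk msize) (mapQ (Matrix.diagonal d)) f).trace ∈
        Set.range (intMap n) := by
  obtain ⟨g, rfl⟩ := hf
  rw [Zof_int msize A hA]
  have h1 := trace_int msize (A * (A - Aᵀ)⁻¹) g
  refine ⟨h1, fun d hd => ?_⟩
  have h2 : Matrix.diagonal d =
      (Matrix.diagonal fun p => if d p = 1 then (1 : ℤ) else 0).map ((↑) : ℤ → ℚ) := by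
    rw [Matrix.diagonal_map Int.cast_zero]
    congr 1
    funext p
    rcases hd.1 p with h | h <;> simp [h]
  rw [h2]
  exact sub_mem h1 (trace_int msize _ g)
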